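/- arXiv:2005.05180 — 2 statements merged into one kernel-verified Lean document; each statement's English description precedes it below -/
import Mathlib

section
/- Let n ≥ 2, let V = {y ∈ ℝⁿ : ‖y‖ < 1 and yₙ > 0} and L = {y ∈ ℝⁿ : ‖y‖ < 1 and yₙ = 0}. Suppose h : V ∪ L → ℝ is continuous, h is harmonic on V, h = 0 on L, and h(ρy) = ρ·h(y) for every y ∈ V and every ρ ∈ (0,1). Then there exists β ∈ ℝ such that h(y) = β·yₙ for all y ∈ V. -/
/-- A function is harmonic on an open set `U ⊆ ℝⁿ` if it is `C²` on `U` and its Laplacian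
`∑ᵢ ∂²f/∂yᵢ²` vanishes identically on `U`. -/
def IsHarmonicOn {n : ℕ} (f : EuclideanSpace ℝ (Fin n) → ℝ)
    (U : Set (EuclideanSpace ℝ (Fin n))) : Prop :=
  ContDiffOn ℝ 2 f U ∧
    ∀ y ∈ U, ∑ i : Fin n,
      fderiv ℝ (fun x => fderiv ℝ f x (EuclideanSpace.single i 1)) y
        (EuclideanSpace.single i 1) = 0

open Filter Topology

theorem second_deriv_nonpos_of_isLocalMax {g g₁ : ℝ → ℝ} {c : ℝ}
    (hg : ∀ᶠ t in 𝓝 (0 : ℝ), HasDerivAt g (g₁ t) t) (hg₁ : HasDerivAt g₁ c 0)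
    (hmax : IsLocalMax g 0) : c ≤ 0 := by
  by_contra! hc
  have hd : deriv g =ᶠ[𝓝 0] g₁ := hg.mono fun t ht => ht.deriv
  have h2 : deriv (deriv g) 0 = c := by rw [hd.deriv_eq, hg₁.deriv]
  have hmin : IsLocalMin g 0 :=
    isLocalMin_of_deriv_deriv_pos (by rw [h2]; exact hc) hmax.deriv_eq_zero
      hg.self_of_nhds.continuousAt
  have hconst : g =ᶠ[𝓝 0] fun _ => g 0 := by
    filter_upwards [hmax, hmin] with t h₁ h₂ using le_antisymm h₁ h₂
  have h3 : deriv (deriv g) 0 = 0 := by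
    rw [hconst.deriv.deriv_eq]
    simp
  linarith

section

variable {E : Type*} [NormedAddCommGroup E] [NormedSpace ℝ E]

theorem hasDerivAt_line (x e : E) (t : ℝ) : HasDerivAt (fun s : ℝ => x + s • e) e t := by
  simpa using ((hasDerivAt_id t).smul_const e).const_add x

theorem ContDiffAt.eventually_hasDerivAt_line {f : E → ℝ} {x : E} (hf : ContDiffAt ℝ 2 f x)
    (e : E) :
    ∀ᶠ t in 𝓝 (0 : ℝ), HasDerivAt (fun s : ℝ => f (x + s • e)) (fderiv ℝ f (x + t • e) e) t := by
  have hlim : Tendsto (fun t : ℝ => x + t • e) (𝓝 0) (𝓝 x) := by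
    simpa using (hasDerivAt_line x e 0).continuousAt.tendsto
  filter_upwards [hlim.eventually (hf.eventually (by simp))] with t ht
  exact (ht.differentiableAt (by simp)).hasFDerivAt.comp_hasDerivAt t (hasDerivAt_line x e t)

theorem ContDiffAt.hasDerivAt_fderiv_line {f : E → ℝ} {x : E} (hf : ContDiffAt ℝ 2 f x)
    (e : E) :
    HasDerivAt (fun t : ℝ => fderiv ℝ f (x + t • e) e)
      (fderiv ℝ (fun y => fderiv ℝ f y e) x e) 0 := by
  have h1 : ContDiffAt ℝ 1 (fderiv ℝ f) x := hf.fderiv_right (by norm_num)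
  have h2 : DifferentiableAt ℝ (fun y => fderiv ℝ f y e) x :=
    (h1.differentiableAt (by simp)).clm_apply (differentiableAt_const e)
  have h3 : HasFDerivAt (fun y => fderiv ℝ f y e) (fderiv ℝ (fun y => fderiv ℝ f y e) x)
      (x + (0 : ℝ) • e) := by simpa using h2.hasFDerivAt
  exact h3.comp_hasDerivAt 0 (hasDerivAt_line x e 0)

end

/-- A difference of a translate of a harmonic function and the function itself, minus a strictly
superharmonic quadratic polynomial, has no interior local maximum. -/
theorem not_isLocalMax_translate_sub {n : ℕ} {h : EuclideanSpace ℝ (Fin n) → ℝ}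
    {U : Set (EuclideanSpace ℝ (Fin n))} (hU : IsOpen U) (hh : IsHarmonicOn h U)
    (m : Fin n) {x w : EuclideanSpace ℝ (Fin n)} (hx : x ∈ U) (hxw : x + w ∈ U)
    {A B C D : ℝ} (hAB : n * A < B) :
    ¬ IsLocalMax (fun y => h (y + w) - h y -
      (A * ‖y‖ ^ 2 - B * y m ^ 2 + C * y m + D)) x := by
  intro hmax
  set e : Fin n → EuclideanSpace ℝ (Fin n) := fun i => EuclideanSpace.single i 1 with he
  have h1 : ContDiffAt ℝ 2 h x := hh.1.contDiffAt (hU.mem_nhds hx)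
  have h2 : ContDiffAt ℝ 2 h (x + w) := hh.1.contDiffAt (hU.mem_nhds hxw)
  have key : ∀ i : Fin n, fderiv ℝ (fun y => fderiv ℝ h y (e i)) (x + w) (e i)
      - fderiv ℝ (fun y => fderiv ℝ h y (e i)) x (e i)
      - (2 * A - (if i = m then 2 * B else 0)) ≤ 0 := by
    intro i
    set d : ℝ := if i = m then 1 else 0 with hd
    have hem : e i m = d := by simp [he, hd, eq_comm]
    have hnorm : ∀ t : ℝ, ‖x + t • e i‖ ^ 2 = ‖x‖ ^ 2 + 2 * t * x i + t ^ 2 := by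
      intro t
      rw [norm_add_sq_real, inner_smul_right, norm_smul, mul_pow]
      simp [he, EuclideanSpace.inner_single_right]
      ring
    have hlim : Tendsto (fun t : ℝ => x + t • e i) (𝓝 0) (𝓝 x) := by
      simpa using (hasDerivAt_line x (e i) 0).continuousAt.tendsto
    have hloc : IsLocalMax (fun t : ℝ => h (x + w + t • e i) - h (x + t • e i) -
        (A * (‖x‖ ^ 2 + 2 * t * x i + t ^ 2) - B * (x m + t * d) ^ 2
          + C * (x m + t * d) + D)) 0 := by
      filter_upwards [hlim.eventually hmax] with t ht
      have h3 := hnorm t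
      simp only [h3, PiLp.add_apply, PiLp.smul_apply, hem, smul_eq_mul] at ht
      simpa [add_right_comm x w] using ht
    have hquad : ∀ t : ℝ, HasDerivAt (fun t : ℝ => A * (‖x‖ ^ 2 + 2 * t * x i + t ^ 2)
        - B * (x m + t * d) ^ 2 + C * (x m + t * d) + D)
        (A * (2 * x i + 2 * t) - B * (2 * (x m + t * d) * d) + C * d) t := by
      intro t
      have a1 : HasDerivAt (fun t : ℝ => x m + t * d) d t := by
        simpa using ((hasDerivAt_id t).mul_const d).const_add (x m)
      have a2 : HasDerivAt (fun t : ℝ => ‖x‖ ^ 2 + 2 * t * x i + t ^ 2) (2 * x i + 2 * t) t := by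
        have := ((((hasDerivAt_id t).const_mul 2).mul_const (x i)).const_add (‖x‖ ^ 2)).add
          (hasDerivAt_pow 2 t)
        simpa only [id_eq, mul_one, Pi.add_def, Nat.cast_ofNat, Nat.add_one_sub_one, pow_one] using! this
      have := (((a2.const_mul A).sub ((a1.pow 2).const_mul B)).add (a1.const_mul C)).add_const D
      simpa using this
    have hquad2 : HasDerivAt (fun t : ℝ => A * (2 * x i + 2 * t) - B * (2 * (x m + t * d) * d)
        + C * d) (2 * A - 2 * B * d) 0 := by
      have a1 : HasDerivAt (fun t : ℝ => x m + t * d) d 0 := by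
        simpa using ((hasDerivAt_id (0 : ℝ)).mul_const d).const_add (x m)
      have a2 : HasDerivAt (fun t : ℝ => 2 * x i + 2 * t) 2 0 := by
        simpa using ((hasDerivAt_id (0 : ℝ)).const_mul 2).const_add (2 * x i)
      have := ((a2.const_mul A).sub (((a1.const_mul 2).mul_const d).const_mul B)).add_const (C * d)
      refine this.congr_deriv ?_
      rw [hd]
      split_ifs <;> ring
    have := second_deriv_nonpos_of_isLocalMax
      (g₁ := fun t => fderiv ℝ h (x + w + t • e i) (e i) - fderiv ℝ h (x + t • e i) (e i)
        - (A * (2 * x i + 2 * t) - B * (2 * (x m + t * d) * d) + C * d))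
      (by
        filter_upwards [h1.eventually_hasDerivAt_line (e i), h2.eventually_hasDerivAt_line (e i)]
          with t b1 b2
        exact (b2.sub b1).sub (hquad t))
      (((h2.hasDerivAt_fderiv_line (e i)).sub (h1.hasDerivAt_fderiv_line (e i))).sub hquad2) hloc
    rw [hd] at this
    split_ifs at this ⊢ <;> linarith
  have hsum := Finset.sum_nonpos fun i (_ : i ∈ Finset.univ) => key i
  simp only [Finset.sum_sub_distrib, Finset.sum_ite_eq', Finset.mem_univ, if_true,
    Finset.sum_const, Finset.card_univ, Fintype.card_fin, nsmul_eq_mul] at hsum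
  rw [hh.2 x hx, hh.2 (x + w) hxw] at hsum
  linarith

/-- Comparison with a harmonic quadratic polynomial on the upper half ball of radius `1/2`. -/
theorem translate_sub_le {n : ℕ} (m : Fin n) {h : EuclideanSpace ℝ (Fin n) → ℝ}
    (hcont : ContinuousOn h {y | ‖y‖ < 1 ∧ 0 ≤ y m})
    (hh : IsHarmonicOn h {y | ‖y‖ < 1 ∧ 0 < y m})
    (hzero : ∀ y : EuclideanSpace ℝ (Fin n), ‖y‖ < 1 → y m = 0 → h y = 0)
    {w : EuclideanSpace ℝ (Fin n)} (hw : ‖w‖ < 1 / 2) (hwm : w m = 0) {ε : ℝ} (hε : 0 ≤ ε)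
    (hbound : ∀ y : EuclideanSpace ℝ (Fin n), ‖y‖ ≤ 1 / 2 → 0 ≤ y m → h (y + w) - h y ≤ ε)
    {x : EuclideanSpace ℝ (Fin n)} (hx : ‖x‖ ≤ 1 / 2) (hxm : 0 ≤ x m) :
    h (x + w) - h x ≤ ε * (4 * (‖x‖ ^ 2 - n * x m ^ 2) + 2 * n * x m) := by
  have hn : (0 : ℝ) < n := by exact_mod_cast m.pos
  have hcm : Continuous fun y : EuclideanSpace ℝ (Fin n) => y m := by fun_prop
  have hVo : IsOpen {y : EuclideanSpace ℝ (Fin n) | ‖y‖ < 1 ∧ 0 < y m} :=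
    (isOpen_lt continuous_norm continuous_const).inter (isOpen_lt continuous_const hcm)
  have hKw : ∀ y : EuclideanSpace ℝ (Fin n), ‖y‖ ≤ 1 / 2 → ‖y + w‖ < 1 := fun y hy =>
    (norm_add_le y w).trans_lt (by linarith)
  refine le_of_forall_pos_le_add fun δ hδ => ?_
  set K : Set (EuclideanSpace ℝ (Fin n)) := {y | ‖y‖ ≤ 1 / 2 ∧ 0 ≤ y m} with hK
  have hKc : IsCompact K := by
    have : K = Metric.closedBall 0 (1 / 2) ∩ {y | 0 ≤ y m} := by ext; simp [hK]
    rw [this]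
    exact (isCompact_closedBall 0 (1 / 2)).inter_right (isClosed_le continuous_const hcm)
  set G : EuclideanSpace ℝ (Fin n) → ℝ := fun y => h (y + w) - h y -
      ((4 * ε - δ) * ‖y‖ ^ 2 - (4 * n * ε) * y m ^ 2 + (2 * n * ε) * y m + δ / 4) with hG
  have hGc : ContinuousOn G K := by
    have c1 : ContinuousOn h K := hcont.mono fun y hy => ⟨by linarith [hy.1], hy.2⟩
    have c2 : ContinuousOn (fun y => h (y + w)) K :=
      hcont.comp (by fun_prop) fun y hy => ⟨hKw y hy.1, by simpa [hwm] using hy.2⟩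
    exact (c2.sub c1).sub (by fun_prop)
  obtain ⟨z, hzK, hzmax⟩ := hKc.exists_isMaxOn ⟨x, hx, hxm⟩ hGc
  have hzle : G z ≤ 0 := by
    rcases eq_or_lt_of_le hzK.2 with hz0 | hz0
    · have e1 : h z = 0 := hzero z (by linarith [hzK.1]) hz0.symm
      have e2 : h (z + w) = 0 := hzero _ (hKw z hzK.1) (by simp [hwm, ← hz0])
      have : ‖z‖ ^ 2 ≤ 1 / 4 := by nlinarith [hzK.1, norm_nonneg z]
      simp only [hG, e1, e2, ← hz0]
      nlinarith [mul_nonneg hε (sq_nonneg ‖z‖), mul_le_mul_of_nonneg_left this hδ.le]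
    · rcases eq_or_lt_of_le hzK.1 with hz1 | hz1
      · have e1 := hbound z hzK.1 hzK.2
        have e2 : z m ≤ 1 / 2 := (le_abs_self _).trans
          ((PiLp.norm_apply_le z m).trans hzK.1)
        simp only [hG, hz1]
        have : 0 ≤ (n * ε) * (z m * (1 / 2 - z m)) := by
          have := sub_nonneg.2 e2
          positivity
        nlinarith
      · exfalso
        refine not_isLocalMax_translate_sub hVo hh m (x := z) (w := w)
          ⟨by linarith, hz0⟩ ⟨hKw z hzK.1, by simpa [hwm] using hz0⟩
          (A := 4 * ε - δ) (B := 4 * n * ε) (C := 2 * n * ε) (D := δ / 4)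
          (by nlinarith [mul_pos hn hδ]) (hzmax.isLocalMax ?_)
        filter_upwards [(isOpen_lt continuous_norm continuous_const).mem_nhds hz1,
          (isOpen_lt continuous_const hcm).mem_nhds hz0] with y hy1 hy2
        exact ⟨le_of_lt hy1, le_of_lt hy2⟩
  have hxle : G x ≤ 0 := (hzmax ⟨hx, hxm⟩).trans hzle
  simp only [hG] at hxle
  nlinarith [mul_nonneg hδ.le (sq_nonneg ‖x‖)]

/-- A positively 1-homogeneous harmonic function on the half ball vanishing on the flat face
is invariant under translations parallel to the face; by symmetry one inequality suffices. -/
theorem le_of_coord_eq {n : ℕ} (m : Fin n) {h : EuclideanSpace ℝ (Fin n) → ℝ}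
    (hcont : ContinuousOn h {y | ‖y‖ < 1 ∧ 0 ≤ y m})
    (hh : IsHarmonicOn h {y | ‖y‖ < 1 ∧ 0 < y m})
    (hzero : ∀ y : EuclideanSpace ℝ (Fin n), ‖y‖ < 1 → y m = 0 → h y = 0)
    (hhom : ∀ y : EuclideanSpace ℝ (Fin n), ‖y‖ < 1 → 0 < y m →
      ∀ ρ : ℝ, 0 < ρ → ρ < 1 → h (ρ • y) = ρ * h y)
    {y z : EuclideanSpace ℝ (Fin n)} (hy : ‖y‖ < 1) (hym : 0 < y m) (hz : ‖z‖ < 1)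
    (hzy : z m = y m) : h z ≤ h y := by
  have hcm : Continuous fun y : EuclideanSpace ℝ (Fin n) => y m := by fun_prop
  refine le_of_forall_pos_le_add fun η hη => ?_
  obtain ⟨ε, hε, hεη⟩ : ∃ ε : ℝ, 0 < ε ∧ ε * (4 + 2 * n) = η :=
    ⟨η / (4 + 2 * n), by positivity, by field_simp⟩
  set K : Set (EuclideanSpace ℝ (Fin n)) := {y | ‖y‖ ≤ 3 / 4 ∧ 0 ≤ y m} with hK
  have hKc : IsCompact K := by
    have : K = Metric.closedBall 0 (3 / 4) ∩ {y | 0 ≤ y m} := by ext; simp [hK]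
    rw [this]
    exact (isCompact_closedBall 0 (3 / 4)).inter_right (isClosed_le continuous_const hcm)
  have huc := hKc.uniformContinuousOn_of_continuous
    (hcont.mono fun y hy => ⟨by linarith [hy.1], hy.2⟩)
  obtain ⟨r, hr, hunif⟩ := Metric.uniformContinuousOn_iff.1 huc ε hε
  obtain ⟨s, hs0, hs⟩ : ∃ s : ℝ, 0 < s ∧ s < 1 / 2 ∧ 2 * s < r ∧ 2 * s < 1 / 4 := by
    refine ⟨min (r / 4) (1 / 16), by positivity, ?_⟩
    have h1 := min_le_left (r / 4) (1 / 16)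
    have h2 := min_le_right (r / 4) (1 / 16)
    refine ⟨by linarith, by linarith, by linarith⟩
  have hwn : ‖s • (z - y)‖ ≤ 2 * s := by
    rw [norm_smul, Real.norm_of_nonneg hs0.le]
    nlinarith [norm_sub_le z y]
  have hwm : (s • (z - y)) m = 0 := by simp [hzy]
  have hsy : ‖s • y‖ = s * ‖y‖ := by rw [norm_smul, Real.norm_of_nonneg hs0.le]
  have hsm : (s • y) m = s * y m := by simp
  have hmain := translate_sub_le m hcont hh hzero (w := s • (z - y)) (by linarith) hwm hε.le
    (fun u hu hum => by
      have hlt := hunif (u + s • (z - y))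
        ⟨(norm_add_le _ _).trans (by linarith), by simpa [hzy] using hum⟩ u
        ⟨by linarith, hum⟩ (by rw [dist_eq_norm, add_sub_cancel_left]; linarith)
      rw [Real.dist_eq] at hlt
      exact (le_abs_self _).trans hlt.le)
    (x := s • y) (by rw [hsy]; nlinarith [norm_nonneg y]) (by rw [hsm]; positivity)
  have hadd : s • y + s • (z - y) = s • z := by rw [← smul_add, add_sub_cancel]
  rw [hadd, hhom z hz (hzy ▸ hym) s hs0 (by linarith), hhom y hy hym s hs0 (by linarith),
    hsy, hsm] at hmain
  have hym1 : y m ≤ 1 := (le_abs_self _).trans ((PiLp.norm_apply_le y m).trans hy.le)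
  have hrhs : 4 * ((s * ‖y‖) ^ 2 - n * (s * y m) ^ 2) + 2 * n * (s * y m) ≤ s * (4 + 2 * n) := by
    have b1 : (s * ‖y‖) ^ 2 ≤ s := by
      have : s * ‖y‖ ≤ s := by nlinarith
      nlinarith [mul_nonneg hs0.le (norm_nonneg y)]
    have b2 : 0 ≤ n * (s * y m) ^ 2 := by positivity
    have b3 : (n : ℝ) * (s * y m) ≤ n * s := by
      gcongr
      nlinarith
    linarith
  have hfin : s * (h z - h y) ≤ s * η := by
    have := mul_le_mul_of_nonneg_left hrhs hε.le
    rw [← hεη]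
    linarith
  linarith [le_of_mul_le_mul_left hfin hs0]

/-- a positively 1-homogeneous harmonic function on the open upper half unit
ball `V` of `ℝⁿ`, continuous up to the flat face `L` and vanishing there, is a multiple of
the linear function `yₙ`. -/
theorem stmt_4 (n : ℕ) (hn : 2 ≤ n)
    (V L : Set (EuclideanSpace ℝ (Fin n)))
    (hV : V = {y : EuclideanSpace ℝ (Fin n) | ‖y‖ < 1 ∧ 0 < y ⟨n - 1, by omega⟩})
    (hL : L = {y : EuclideanSpace ℝ (Fin n) | ‖y‖ < 1 ∧ y ⟨n - 1, by omega⟩ = 0})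
    (h : EuclideanSpace ℝ (Fin n) → ℝ)
    (hcont : ContinuousOn h (V ∪ L))
    (hharm : IsHarmonicOn h V)
    (hzero : ∀ y ∈ L, h y = 0)
    (hhom : ∀ y ∈ V, ∀ ρ : ℝ, 0 < ρ → ρ < 1 → h (ρ • y) = ρ * h y) :
    ∃ β : ℝ, ∀ y ∈ V, h y = β * y ⟨n - 1, by omega⟩ := by
  set m : Fin n := ⟨n - 1, by omega⟩ with hm
  subst hV hL
  have hVL : {y : EuclideanSpace ℝ (Fin n) | ‖y‖ < 1 ∧ 0 < y m} ∪
      {y : EuclideanSpace ℝ (Fin n) | ‖y‖ < 1 ∧ y m = 0} = {y | ‖y‖ < 1 ∧ 0 ≤ y m} := by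
    ext y
    simp only [Set.mem_union, Set.mem_ofPred_eq, ← and_or_left, le_iff_lt_or_eq,
      eq_comm (a := (0 : ℝ))]
  rw [hVL] at hcont
  have hinv : ∀ {y z : EuclideanSpace ℝ (Fin n)}, ‖y‖ < 1 → 0 < y m → ‖z‖ < 1 → z m = y m →
      h z ≤ h y := le_of_coord_eq m hcont hharm (fun y hy hy0 => hzero y ⟨hy, hy0⟩)
    (fun y hy hy0 => hhom y ⟨hy, hy0⟩)
  set c : EuclideanSpace ℝ (Fin n) := EuclideanSpace.single m (1 / 2) with hc
  have hcn : ‖c‖ < 1 := by simp [hc]; norm_num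
  have hcm : c m = 1 / 2 := by simp [hc]
  refine ⟨2 * h c, fun y hy => ?_⟩
  have hy1 : y m < 1 := ((le_abs_self _).trans (PiLp.norm_apply_le y m)).trans_lt hy.1
  have e1 := hhom y hy (1 / 2) (by norm_num) (by norm_num)
  have e2 := hhom c ⟨hcn, by rw [hcm]; norm_num⟩ (y m) hy.2 hy1
  have n1 : ‖(1 / 2 : ℝ) • y‖ < 1 := by
    rw [norm_smul]
    norm_num
    linarith [hy.1]
  have n2 : ‖y m • c‖ < 1 := by
    rw [norm_smul, Real.norm_of_nonneg hy.2.le]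
    nlinarith [norm_nonneg c, hy.2]
  have m1 : ((1 / 2 : ℝ) • y) m = y m / 2 := by simp; ring
  have m2 : (y m • c) m = y m / 2 := by simp [hcm]; ring
  have hpos : 0 < y m / 2 := half_pos hy.2
  have e3 : h ((1 / 2 : ℝ) • y) = h (y m • c) :=
    le_antisymm (hinv n2 (m2 ▸ hpos) n1 (m1.trans m2.symm))
      (hinv n1 (m1 ▸ hpos) n2 (m2.trans m1.symm))
  linarith
end

section
/- Let n ≥ 2, let V = {y ∈ ℝⁿ : ‖y‖ < 1 and yₙ > 0} and L = {y ∈ ℝⁿ : ‖y‖ < 1 and yₙ = 0}, and let eₙ be the n-th standard basis vector of ℝⁿ. Suppose h : V ∪ L → ℝ is continuous, h is harmonic on V, and h = 0 on L. Then the limit β := lim_{t→0⁺} h(t·eₙ)/t exists, and there is a constant C depending only on n such that |β| ≤ C·(∫_{V ∩ B(0,1/2)} h(z)² dz)^(1/2) and |h(y) − β·yₙ| ≤ C‖y‖²·(∫_{V ∩ B(0,1/2)} h(z)² dz)^(1/2) for every y ∈ V with ‖y‖ ≤ 1/4. -/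
open Metric MeasureTheory

open scoped ContDiff

namespace HarmonicHalfBall

variable {n : ℕ}

local notation "𝔼" n => EuclideanSpace ℝ (Fin n)

/-- The `i`-th partial derivative. -/
noncomputable def partialDeriv (i : Fin n) (f : (𝔼 n) → ℝ) (x : 𝔼 n) : ℝ :=
  fderiv ℝ f x (EuclideanSpace.single i 1)

/-- The Laplacian as the sum of the second partial derivatives. -/
noncomputable def laplace (f : (𝔼 n) → ℝ) (x : 𝔼 n) : ℝ :=
  ∑ i, partialDeriv i (partialDeriv i f) x

lemma contDiff_partialDeriv {f : (𝔼 n) → ℝ} {m k : ℕ∞ω} (hf : ContDiff ℝ k f) (hmk : m + 1 ≤ k)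
    (i : Fin n) : ContDiff ℝ m (partialDeriv i f) :=
  (hf.fderiv_right hmk).clm_apply contDiff_const

lemma contDiffOn_partialDeriv {f : (𝔼 n) → ℝ} {U : Set (𝔼 n)} {m k : ℕ∞ω}
    (hf : ContDiffOn ℝ k f U) (hU : IsOpen U) (hmk : m + 1 ≤ k)
    (i : Fin n) : ContDiffOn ℝ m (partialDeriv i f) U :=
  (hf.fderiv_of_isOpen hU hmk).clm_apply contDiffOn_const

lemma tsupport_partialDeriv_subset (f : (𝔼 n) → ℝ) (i : Fin n) :
    tsupport (partialDeriv i f) ⊆ tsupport f :=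
  tsupport_fderiv_apply_subset ℝ _

lemma hasCompactSupport_partialDeriv {f : (𝔼 n) → ℝ} (hf : HasCompactSupport f) (i : Fin n) :
    HasCompactSupport (partialDeriv i f) :=
  hf.fderiv_apply ℝ _

lemma integrable_mul_of_tsupport_subset {U : Set (𝔼 n)} {u v : (𝔼 n) → ℝ}
    (hu : ContinuousOn u U) (hU : IsOpen U) (hv : Continuous v) (hc : HasCompactSupport v)
    (hvU : tsupport v ⊆ U) : Integrable (fun x => u x * v x) := by
  refine Continuous.integrable_of_hasCompactSupport ?_ hc.mul_left
  rw [continuous_iff_continuousAt]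
  intro x
  by_cases hx : x ∈ tsupport v
  · exact (hu.continuousAt (hU.mem_nhds (hvU hx))).mul hv.continuousAt
  · have h0 : (fun x => u x * v x) =ᶠ[nhds x] fun _ => 0 := by
      filter_upwards [notMem_tsupport_iff_eventuallyEq.1 hx] with y hy
      simp [hy]
    exact continuousAt_const.congr h0.symm

/-- Green's second identity for a harmonic function and a compactly supported test function. -/
lemma integral_mul_laplace_eq_zero {U : Set (𝔼 n)} (hU : IsOpen U) {h φ : (𝔼 n) → ℝ}
    (hh : ContDiffOn ℝ 2 h U) (hlap : ∀ x ∈ U, laplace h x = 0)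
    (hφ : ContDiff ℝ 2 φ) (hc : HasCompactSupport φ) (hs : tsupport φ ⊆ U) :
    ∫ x, h x * laplace φ x = 0 := by
  have d1 : ∀ i, ContDiff ℝ 1 (partialDeriv i φ) := fun i =>
    contDiff_partialDeriv hφ (by norm_num) i
  have d2 : ∀ i, ContDiff ℝ 0 (partialDeriv i (partialDeriv i φ)) := fun i =>
    contDiff_partialDeriv (d1 i) (by norm_num) i
  have e1 : ∀ i, ContDiffOn ℝ 1 (partialDeriv i h) U := fun i =>
    contDiffOn_partialDeriv hh hU (by norm_num) i
  have e2 : ∀ i, ContDiffOn ℝ 0 (partialDeriv i (partialDeriv i h)) U := fun i =>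
    contDiffOn_partialDeriv (e1 i) hU (by norm_num) i
  have c1 := fun i => hasCompactSupport_partialDeriv hc i
  have c2 := fun i => hasCompactSupport_partialDeriv (c1 i) i
  have s1 : ∀ i, tsupport (partialDeriv i φ) ⊆ U := fun i =>
    (tsupport_partialDeriv_subset φ i).trans hs
  have s2 : ∀ i, tsupport (partialDeriv i (partialDeriv i φ)) ⊆ U := fun i =>
    (tsupport_partialDeriv_subset _ i).trans (s1 i)
  have i02 := fun i => integrable_mul_of_tsupport_subset hh.continuousOn hU (d2 i).continuous
    (c2 i) (s2 i)
  have i01 := fun i => integrable_mul_of_tsupport_subset hh.continuousOn hU (d1 i).continuous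
    (c1 i) (s1 i)
  have i11 := fun i => integrable_mul_of_tsupport_subset (e1 i).continuousOn hU
    (d1 i).continuous (c1 i) (s1 i)
  have i10 := fun i => integrable_mul_of_tsupport_subset (e1 i).continuousOn hU
    hφ.continuous hc hs
  have i20 := fun i => integrable_mul_of_tsupport_subset (e2 i).continuousOn hU
    hφ.continuous hc hs
  have key : ∀ i, ∫ x, h x * partialDeriv i (partialDeriv i φ) x
      = ∫ x, partialDeriv i (partialDeriv i h) x * φ x := by
    intro i
    have A := integral_mul_fderiv_eq_neg_fderiv_mul_of_integrable (μ := volume)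
      (f := h) (g := partialDeriv i φ) (v := EuclideanSpace.single i (1 : ℝ)) (i11 i) (i02 i)
      (i01 i)
      (fun x hx => (hh.contDiffAt (hU.mem_nhds (s1 i hx))).differentiableAt (by norm_num))
      (fun x _ => (d1 i).differentiable (by norm_num) x)
    have B := integral_mul_fderiv_eq_neg_fderiv_mul_of_integrable (μ := volume)
      (f := partialDeriv i h) (g := φ) (v := EuclideanSpace.single i (1 : ℝ)) (i20 i) (i11 i)
      (i10 i)
      (fun x hx => ((e1 i).contDiffAt (hU.mem_nhds (hs hx))).differentiableAt (by norm_num))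
      (fun x _ => hφ.differentiable (by norm_num) x)
    change ∫ x, h x * partialDeriv i (partialDeriv i φ) x
      = - ∫ x, partialDeriv i h x * partialDeriv i φ x at A
    change ∫ x, partialDeriv i h x * partialDeriv i φ x
      = - ∫ x, partialDeriv i (partialDeriv i h) x * φ x at B
    rw [A, B, neg_neg]
  calc ∫ x, h x * laplace φ x = ∑ i, ∫ x, h x * partialDeriv i (partialDeriv i φ) x := by
        rw [← integral_finsetSum _ fun i _ => i02 i]
        simp only [laplace, Finset.mul_sum]
    _ = ∑ i, ∫ x, partialDeriv i (partialDeriv i h) x * φ x := Finset.sum_congr rfl fun i _ => key i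
    _ = ∫ x, laplace h x * φ x := by
        rw [← integral_finsetSum _ fun i _ => i20 i]
        simp only [laplace, Finset.sum_mul]
    _ = 0 := by
        refine integral_eq_zero_of_ae (Filter.Eventually.of_forall fun x => ?_)
        by_cases hx : x ∈ U
        · simp [hlap x hx]
        · simp [image_eq_zero_of_notMem_tsupport fun hx' => hx (hs hx')]

lemma partialDeriv_cutoff_mul {χ : ℝ → ℝ} {φ : (𝔼 n) → ℝ} (hχ : Differentiable ℝ χ)
    (hφ : Differentiable ℝ φ) (s : ℝ) (k i : Fin n) :
    partialDeriv i (fun z => χ (s * z k) * φ z) = fun x =>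
      (if i = k then s else 0) * (deriv χ (s * x k) * φ x) + χ (s * x k) * partialDeriv i φ x := by
  funext x
  have h1 : HasFDerivAt (fun z : 𝔼 n => s * z k) (s • EuclideanSpace.proj (𝕜 := ℝ) k) x :=
    (EuclideanSpace.proj (𝕜 := ℝ) k : (𝔼 n) →L[ℝ] ℝ).hasFDerivAt.const_mul s
  have h2 := (hχ (s * x k)).hasDerivAt.comp_hasFDerivAt x h1
  have h3 : HasFDerivAt (fun z => χ (s * z k) * φ z) _ x := h2.mul (hφ x).hasFDerivAt
  rw [partialDeriv, h3.fderiv, partialDeriv]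
  by_cases hik : i = k
  · subst hik
    simp
    ring
  · simp [hik, Ne.symm hik]

lemma partialDeriv_add {f g : (𝔼 n) → ℝ} (hf : Differentiable ℝ f) (hg : Differentiable ℝ g)
    (i : Fin n) :
    partialDeriv i (fun z => f z + g z) = fun x => partialDeriv i f x + partialDeriv i g x := by
  funext x
  simp [partialDeriv, fderiv_fun_add (hf x) (hg x)]

lemma partialDeriv_const_mul {f : (𝔼 n) → ℝ} (hf : Differentiable ℝ f) (c : ℝ) (i : Fin n) :
    partialDeriv i (fun z => c * f z) = fun x => c * partialDeriv i f x := by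
  funext x
  simp [partialDeriv, fderiv_const_mul (hf x)]

lemma laplace_cutoff_mul {χ : ℝ → ℝ} {φ : (𝔼 n) → ℝ} (hχ : ContDiff ℝ 2 χ)
    (hφ : ContDiff ℝ 2 φ) (s : ℝ) (k : Fin n) (x : 𝔼 n) :
    laplace (fun z => χ (s * z k) * φ z) x = χ (s * x k) * laplace φ x
      + 2 * s * deriv χ (s * x k) * partialDeriv k φ x
      + s ^ 2 * deriv (deriv χ) (s * x k) * φ x := by
  have hχ' : ContDiff ℝ 1 (deriv χ) := hχ.deriv' (n := 1)
  have hχd := hχ.differentiable (by norm_num)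
  have hφd := hφ.differentiable (by norm_num)
  have hχd' := hχ'.differentiable (by norm_num)
  have hφd' : ∀ i, Differentiable ℝ (partialDeriv i φ) := fun i =>
    (contDiff_partialDeriv hφ (m := 1) (by norm_num) i).differentiable (by norm_num)
  have hp : Differentiable ℝ fun z : 𝔼 n => s * z k := by fun_prop
  have key : ∀ i, partialDeriv i (partialDeriv i (fun z => χ (s * z k) * φ z)) x =
      χ (s * x k) * partialDeriv i (partialDeriv i φ) x
      + (if i = k then 2 * s * deriv χ (s * x k) * partialDeriv k φ x
          + s ^ 2 * deriv (deriv χ) (s * x k) * φ x else 0) := by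
    intro i
    rw [partialDeriv_cutoff_mul hχd hφd, partialDeriv_add, partialDeriv_const_mul,
      partialDeriv_cutoff_mul hχd' hφd, partialDeriv_cutoff_mul hχd (hφd' i)]
    · by_cases hik : i = k
      · subst hik
        simp
        ring
      · simp [hik]
    · exact (hχd'.comp hp).mul hφd
    · exact ((hχd'.comp hp).mul hφd).const_mul _
    · exact (hχd.comp hp).mul (hφd' i)
  simp only [laplace, key, Finset.sum_add_distrib, Finset.mul_sum, Finset.sum_ite_eq',
    Finset.mem_univ, if_true]
  ring

/-- The volume of a slab of thickness `2 * δ` in the unit ball. -/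
lemma volume_slab_le (k : Fin n) {δ : ℝ} (hδ : 0 ≤ δ) :
    volume {z : 𝔼 n | ‖z‖ ≤ 1 ∧ 0 ≤ z k ∧ z k ≤ 2 * δ} ≤ ENNReal.ofReal (2 ^ n * δ) := by
  classical
  set lo : Fin n → ℝ := fun i => if i = k then 0 else -1
  set hi : Fin n → ℝ := fun i => if i = k then 2 * δ else 1
  calc volume {z : 𝔼 n | ‖z‖ ≤ 1 ∧ 0 ≤ z k ∧ z k ≤ 2 * δ}
      ≤ volume ((@WithLp.ofLp 2 (Fin n → ℝ)) ⁻¹' Set.Icc lo hi) := by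
        refine measure_mono fun z hz => ?_
        obtain ⟨hz1, hz2, hz3⟩ := hz
        have hb : ∀ i, |z i| ≤ 1 := fun i => (PiLp.norm_apply_le z i).trans hz1
        refine ⟨fun i => ?_, fun i => ?_⟩
        · by_cases hi : i = k
          · subst hi; simpa [lo] using hz2
          · simpa [lo, hi] using (abs_le.1 (hb i)).1
        · by_cases hi' : i = k
          · subst hi'; simpa [hi] using hz3
          · simpa [hi, hi'] using (abs_le.1 (hb i)).2
    _ = volume (Set.Icc lo hi) :=
        (PiLp.volume_preserving_ofLp (Fin n)).measure_preimage measurableSet_Icc.nullMeasurableSet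
    _ = ENNReal.ofReal (∏ i, (hi i - lo i)) := by
        rw [Real.volume_Icc_pi, ENNReal.ofReal_prod_of_nonneg]
        intro i _
        by_cases h : i = k <;> simp [hi, lo, h, hδ]
    _ = ENNReal.ofReal (2 ^ n * δ) := by
        congr 1
        have : ∀ i, hi i - lo i = 2 * if i = k then δ else 1 := by
          intro i
          by_cases h : i = k <;> simp [hi, lo, h]
          norm_num
        simp_rw [this]
        rw [Finset.prod_mul_distrib, Finset.prod_ite_eq']
        simp

lemma exists_cutoff : ∃ (χ : ℝ → ℝ) (M : ℝ), ContDiff ℝ 2 χ ∧ (∀ t ≤ 1, χ t = 0) ∧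
    (∀ t, |χ t - 1| ≤ 1) ∧ (∀ t, |deriv χ t| ≤ M) ∧ (∀ t, |deriv (deriv χ) t| ≤ M) ∧
    ∀ t, 2 < t → χ t = 1 ∧ deriv χ t = 0 ∧ deriv (deriv χ) t = 0 := by
  set χ : ℝ → ℝ := fun t => Real.smoothTransition (t - 1)
  have hχ : ContDiff ℝ 2 χ := Real.smoothTransition.contDiff.comp (contDiff_id.sub contDiff_const)
  have hχ' : ContDiff ℝ 1 (deriv χ) := hχ.deriv' (n := 1)
  have hlow : ∀ t ≤ 1, χ t = 0 := fun t ht =>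
    Real.smoothTransition.zero_of_nonpos (by linarith)
  have hhigh : ∀ t, 2 < t → χ t = 1 := fun t ht =>
    Real.smoothTransition.one_of_one_le (by linarith)
  have dlow : ∀ t, t < 1 → deriv χ t = 0 := fun t ht => by
    have : χ =ᶠ[nhds t] fun _ => 0 := by
      filter_upwards [Iio_mem_nhds ht] with u hu using hlow u (le_of_lt hu)
    rw [this.deriv_eq, deriv_const]
  have dhigh : ∀ t, 2 < t → deriv χ t = 0 := fun t ht => by
    have : χ =ᶠ[nhds t] fun _ => 1 := by
      filter_upwards [Ioi_mem_nhds ht] with u hu using hhigh u hu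
    rw [this.deriv_eq, deriv_const]
  have ddhigh : ∀ t, 2 < t → deriv (deriv χ) t = 0 := fun t ht => by
    have : deriv χ =ᶠ[nhds t] fun _ => 0 := by
      filter_upwards [Ioi_mem_nhds ht] with u hu using dhigh u hu
    rw [this.deriv_eq, deriv_const]
  have hsupp : HasCompactSupport (deriv χ) :=
    HasCompactSupport.intro (isCompact_Icc (a := 1) (b := 2)) fun t ht => by
      rw [Set.mem_Icc, not_and_or, not_le, not_le] at ht
      exact ht.elim (dlow t) (dhigh t)
  obtain ⟨M₁, hM₁⟩ := hsupp.exists_bound_of_continuous hχ'.continuous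
  obtain ⟨M₂, hM₂⟩ := hsupp.deriv.exists_bound_of_continuous
    (hχ'.continuous_deriv le_rfl)
  refine ⟨χ, max M₁ M₂, hχ, hlow, fun t => ?_, fun t => (hM₁ t).trans (le_max_left _ _),
    fun t => (hM₂ t).trans (le_max_right _ _), fun t ht => ⟨hhigh t ht, dhigh t ht, ddhigh t ht⟩⟩
  rw [abs_le]
  constructor <;> linarith [Real.smoothTransition.nonneg (t - 1),
      Real.smoothTransition.le_one (t - 1)]

/-- The open half ball of radius `1 / 2` on which the `k`-th coordinate is positive. -/
def halfBall (k : Fin n) : Set (𝔼 n) := {y | ‖y‖ < 1 / 2 ∧ 0 < y k}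

lemma isOpen_halfBall (k : Fin n) : IsOpen (halfBall k) :=
  (isOpen_lt continuous_norm continuous_const).inter
    (isOpen_lt continuous_const (EuclideanSpace.proj (𝕜 := ℝ) k).continuous)

/-- The closure of `halfBall k`. -/
def closedHalfBall (k : Fin n) : Set (𝔼 n) := {y | ‖y‖ ≤ 1 / 2 ∧ 0 ≤ y k}

lemma halfBall_subset_closedHalfBall (k : Fin n) : halfBall k ⊆ closedHalfBall k :=
  fun _ hy => ⟨hy.1.le, hy.2.le⟩

lemma isCompact_closedHalfBall (k : Fin n) : IsCompact (closedHalfBall k) := by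
  have : closedHalfBall k = closedBall (0 : 𝔼 n) (1 / 2) ∩ {y | 0 ≤ y k} := by
    ext y; simp [closedHalfBall]
  rw [this]
  exact (isCompact_closedBall _ _).inter_right
    (isClosed_le continuous_const (EuclideanSpace.proj (𝕜 := ℝ) k).continuous)

lemma integrableOn_mul_of_continuousOn {k : Fin n} {h g : (𝔼 n) → ℝ}
    (hc : ContinuousOn h (closedHalfBall k)) (hg : Continuous g) :
    IntegrableOn (fun z => h z * g z) (halfBall k) :=
  ((hc.mul hg.continuousOn).integrableOn_compact (isCompact_closedHalfBall k)).mono_set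
    (halfBall_subset_closedHalfBall k)

/-- The orthogonal projection to the hyperplane `y k = 0` does not increase the norm. -/
lemma norm_sub_single_le (k : Fin n) (z : 𝔼 n) :
    ‖z - EuclideanSpace.single k (z k)‖ ≤ ‖z‖ := by
  refine le_of_sq_le_sq ?_ (norm_nonneg _)
  rw [EuclideanSpace.norm_sq_eq, EuclideanSpace.norm_sq_eq]
  refine Finset.sum_le_sum fun i _ => ?_
  by_cases hik : i = k
  · subst hik; simpa using sq_nonneg (z i)
  · simp [hik]

lemma continuous_laplace {φ : (𝔼 n) → ℝ} (hφ : ContDiff ℝ 2 φ) : Continuous (laplace φ) :=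
  continuous_finsetSum _ fun i _ => (contDiff_partialDeriv (m := 0)
    (contDiff_partialDeriv (m := 1) hφ (by norm_num) i) (by norm_num) i).continuous

lemma support_laplace_subset (φ : (𝔼 n) → ℝ) :
    Function.support (laplace φ) ⊆ tsupport φ := by
  intro x hx
  obtain ⟨i, -, hi⟩ := Finset.exists_ne_zero_of_sum_ne_zero hx
  exact tsupport_partialDeriv_subset _ i
    (tsupport_partialDeriv_subset _ i (subset_tsupport _ hi))

lemma hasCompactSupport_laplace {φ : (𝔼 n) → ℝ} (hφ : HasCompactSupport φ) :
    HasCompactSupport (laplace φ) :=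
  hφ.mono' (support_laplace_subset φ)

/-- Green's second identity on the half ball, for a harmonic function and a test function that both
vanish on the flat face. -/
lemma integral_halfBall_mul_laplace_eq_zero {k : Fin n} {h φ : (𝔼 n) → ℝ}
    (hc : ContinuousOn h (closedHalfBall k)) (hh : ContDiffOn ℝ 2 h (halfBall k))
    (hlap : ∀ x ∈ halfBall k, laplace h x = 0)
    (h0 : ∀ y ∈ closedHalfBall k, y k = 0 → h y = 0)
    (hφ : ContDiff ℝ 2 φ) (hs : tsupport φ ⊆ ball 0 (1 / 2)) (hφ0 : ∀ z, z k = 0 → φ z = 0) :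
    ∫ z in halfBall k, h z * laplace φ z = 0 := by
  have hcs : HasCompactSupport φ :=
    (isCompact_closedBall (0 : 𝔼 n) (1 / 2)).of_isClosed_subset (isClosed_tsupport _)
      (hs.trans ball_subset_closedBall)
  obtain ⟨χ, M, hχ, hχ0, hχ1, hχM, hχM', hχ2⟩ := exists_cutoff
  obtain ⟨M₁, hM₁⟩ := (hasCompactSupport_laplace hcs).exists_bound_of_continuous
    (continuous_laplace hφ)
  obtain ⟨M₂, hM₂⟩ := (hasCompactSupport_partialDeriv hcs k).exists_bound_of_continuous
    (contDiff_partialDeriv (m := 0) hφ (by norm_num) k).continuous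
  obtain ⟨Λ, hΛ⟩ := ContDiff.lipschitzWith_of_hasCompactSupport hcs hφ (by norm_num)
  have hM : 0 ≤ M := (abs_nonneg _).trans (hχM 0)
  have hM₁0 : 0 ≤ M₁ := (norm_nonneg _).trans (hM₁ 0)
  have hM₂0 : 0 ≤ M₂ := (norm_nonneg _).trans (hM₂ 0)
  set D : ℝ := M₁ + 2 * M * M₂ + M * (Λ * 2) with hD
  have hD0 : 0 ≤ D := by positivity
  set I := ∫ z in halfBall k, h z * laplace φ z
  have key : ∀ ε > 0, |I| ≤ ε * (D * 2 ^ n) := by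
    intro ε hε
    obtain ⟨r, hr, hur⟩ := Metric.uniformContinuousOn_iff.1
      ((isCompact_closedHalfBall k).uniformContinuousOn_of_continuous hc) ε hε
    set δ := min 1 (r / 4) with hδ
    have hδ0 : 0 < δ := lt_min one_pos (by positivity)
    have hδ1 : δ ≤ 1 := min_le_left _ _
    have hδr : 2 * δ < r := by linarith [min_le_right 1 (r / 4)]
    set ψ : (𝔼 n) → ℝ := fun z => χ (δ⁻¹ * z k) * φ z with hψ
    have hcoord : Continuous fun z : 𝔼 n => z k := (EuclideanSpace.proj (𝕜 := ℝ) k).continuous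
    have hψd : ContDiff ℝ 2 ψ :=
      (hχ.comp (contDiff_const.mul (EuclideanSpace.proj (𝕜 := ℝ) k).contDiff)).mul hφ
    have hψs : tsupport ψ ⊆ halfBall k := by
      have A : tsupport ψ ⊆ tsupport φ := tsupport_mul_subset_right
      have B : tsupport ψ ⊆ {z | δ ≤ z k} := by
        refine closure_minimal (fun z hz => ?_) (isClosed_le continuous_const hcoord)
        by_contra hlt
        refine hz ?_
        have : δ⁻¹ * z k ≤ 1 := by
          rw [inv_mul_le_iff₀ hδ0]; simpa using (not_le.1 hlt).le
        simp [hψ, hχ0 _ this]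
      exact fun z hz => ⟨by simpa using hs (A hz), hδ0.trans_le (B hz)⟩
    have hψc : HasCompactSupport ψ := hcs.mul_left
    have hψI : ∫ z in halfBall k, h z * laplace ψ z = 0 := by
      rw [setIntegral_eq_integral_of_forall_compl_eq_zero]
      · exact integral_mul_laplace_eq_zero (isOpen_halfBall k) hh hlap hψd hψc hψs
      · intro z hz
        have : laplace ψ z = 0 := by
          by_contra hne
          exact hz (hψs (support_laplace_subset ψ hne))
        simp [this]
    set S : Set (𝔼 n) := {z | z ∈ halfBall k ∧ z k ≤ 2 * δ} with hS
    have hSsub : S ⊆ halfBall k := fun z hz => hz.1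
    have hSvol : volume S ≤ ENNReal.ofReal (2 ^ n * δ) :=
      (measure_mono (t := {z : 𝔼 n | ‖z‖ ≤ 1 ∧ 0 ≤ z k ∧ z k ≤ 2 * δ}) fun z hz =>
        ⟨hz.1.1.le.trans (by norm_num), hz.1.2.le, hz.2⟩).trans (volume_slab_le k hδ0.le)
    have hIS : I = ∫ z in S, h z * (laplace φ z - laplace ψ z) := by
      refine Eq.trans ?_ (setIntegral_eq_of_subset_of_forall_sdiff_eq_zero
        (isOpen_halfBall k).measurableSet hSsub ?_)
      · simp_rw [mul_sub]
        rw [integral_sub (integrableOn_mul_of_continuousOn hc (continuous_laplace hφ))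
          (integrableOn_mul_of_continuousOn hc (continuous_laplace hψd)), hψI, sub_zero]
      · intro z hz
        have hz2 : 2 < δ⁻¹ * z k := by
          have : 2 * δ < z k := not_le.1 fun hle => hz.2 ⟨hz.1, hle⟩
          rw [lt_inv_mul_iff₀ hδ0]
          linarith
        obtain ⟨e1, e2, e3⟩ := hχ2 _ hz2
        rw [hψ, laplace_cutoff_mul hχ hφ, e1, e2, e3]
        ring
    have hbound : ∀ z ∈ S, ‖h z * (laplace φ z - laplace ψ z)‖ ≤ ε * (δ⁻¹ * D) := by
      intro z hz
      set z' := z - EuclideanSpace.single k (z k) with hz'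
      have hz'k : z' k = 0 := by simp [hz']
      have hdist : dist z z' = z k := by
        rw [dist_eq_norm, hz', sub_sub_cancel, PiLp.norm_single, Real.norm_eq_abs,
          abs_of_pos hz.1.2]
      have hz'mem : z' ∈ closedHalfBall k :=
        ⟨(norm_sub_single_le k z).trans hz.1.1.le, hz'k.ge⟩
      have hhz : ‖h z‖ ≤ ε := by
        have := hur z (halfBall_subset_closedHalfBall k hz.1) z' hz'mem
          (by rw [hdist]; exact hz.2.trans_lt hδr)
        rw [h0 z' hz'mem hz'k, dist_zero_right] at this
        exact this.le
      have hφz : |φ z| ≤ Λ * (2 * δ) := by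
        have := hΛ.dist_le_mul z z'
        rw [hφ0 z' hz'k, dist_zero_right, hdist] at this
        exact this.trans (by gcongr; exact hz.2)
      have hδi : 1 ≤ δ⁻¹ := (one_le_inv₀ hδ0).2 hδ1
      rw [norm_mul]
      refine mul_le_mul hhz ?_ (norm_nonneg _) hε.le
      rw [hψ, laplace_cutoff_mul hχ hφ]
      calc ‖laplace φ z - (χ (δ⁻¹ * z k) * laplace φ z
              + 2 * δ⁻¹ * deriv χ (δ⁻¹ * z k) * partialDeriv k φ z
              + δ⁻¹ ^ 2 * deriv (deriv χ) (δ⁻¹ * z k) * φ z)‖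
          = |-((χ (δ⁻¹ * z k) - 1) * laplace φ z)
              - 2 * δ⁻¹ * deriv χ (δ⁻¹ * z k) * partialDeriv k φ z
              - δ⁻¹ ^ 2 * deriv (deriv χ) (δ⁻¹ * z k) * φ z| := by
            rw [Real.norm_eq_abs]; congr 1; ring
        _ ≤ |(χ (δ⁻¹ * z k) - 1) * laplace φ z|
              + |2 * δ⁻¹ * deriv χ (δ⁻¹ * z k) * partialDeriv k φ z|
              + |δ⁻¹ ^ 2 * deriv (deriv χ) (δ⁻¹ * z k) * φ z| := by
            refine (abs_sub _ _).trans (add_le_add_left ((abs_sub _ _).trans ?_) _)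
            rw [abs_neg]
        _ ≤ 1 * M₁ + 2 * δ⁻¹ * M * M₂ + δ⁻¹ ^ 2 * M * (Λ * (2 * δ)) := by
            simp only [abs_mul, abs_pow, abs_two, abs_of_pos (inv_pos.2 hδ0)]
            gcongr
            · exact hχ1 _
            · exact hM₁ z
            · exact hχM _
            · exact hM₂ z
            · exact hχM' _
        _ = M₁ + δ⁻¹ * (2 * M * M₂ + M * (Λ * 2)) := by field_simp; ring
        _ ≤ δ⁻¹ * M₁ + δ⁻¹ * (2 * M * M₂ + M * (Λ * 2)) := by
            gcongr
            exact le_mul_of_one_le_left hM₁0 hδi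
        _ = δ⁻¹ * D := by rw [hD]; ring
    have hSreal : volume.real S ≤ 2 ^ n * δ :=
      ENNReal.toReal_le_of_le_ofReal (by positivity) hSvol
    calc |I| ≤ ε * (δ⁻¹ * D) * volume.real S := by
          rw [hIS]
          exact norm_setIntegral_le_of_norm_le_const (hSvol.trans_lt ENNReal.ofReal_lt_top) hbound
      _ ≤ ε * (δ⁻¹ * D) * (2 ^ n * δ) := by gcongr
      _ = ε * (D * 2 ^ n) := by field_simp
  have hT : 0 ≤ D * 2 ^ n := by positivity
  by_contra hne
  have hpos : 0 < |I| := abs_pos.2 hne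
  have := key (|I| / (D * 2 ^ n + 1)) (by positivity)
  rw [div_mul_eq_mul_div, le_div_iff₀ (by positivity)] at this
  linarith

/-- A nonnegative normalized radial profile supported in `[-1, 1]`. -/
lemma exists_radial_profile (n : ℕ) : ∃ g : ℝ → ℝ, ContDiff ℝ 2 g ∧ (∀ s, 0 ≤ g s) ∧
    HasCompactSupport g ∧ (∀ s, 1 ≤ s → g s = 0) ∧ ∫ z : 𝔼 n, g (‖z‖ ^ 2) = 1 := by
  let f : ContDiffBump (0 : ℝ) := ⟨1 / 2, 1, by norm_num, by norm_num⟩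
  have hf1 : ∀ s, 1 ≤ s → f s = 0 := fun s hs => f.zero_of_le_dist (by
    rw [dist_zero_right]
    exact hs.trans (le_abs_self s))
  have hcont : Continuous fun z : 𝔼 n => f (‖z‖ ^ 2) := f.continuous.comp (by fun_prop)
  have hcs : HasCompactSupport fun z : 𝔼 n => f (‖z‖ ^ 2) :=
    HasCompactSupport.intro (isCompact_closedBall (0 : 𝔼 n) 1) fun z hz => by
      have hz1 : 1 < ‖z‖ := by simpa using hz
      exact hf1 _ (one_le_pow₀ hz1.le)
  have hI : 0 < ∫ z : 𝔼 n, f (‖z‖ ^ 2) :=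
    hcont.integral_pos_of_hasCompactSupport_nonneg_nonzero (x := 0) hcs (fun z => f.nonneg) (by
      have : f (‖(0 : 𝔼 n)‖ ^ 2) = 1 := f.one_of_mem_closedBall (by simp [f])
      rw [this]
      exact one_ne_zero)
  refine ⟨fun s => (∫ z : 𝔼 n, f (‖z‖ ^ 2))⁻¹ * f s, contDiff_const.mul f.contDiff,
    fun s => mul_nonneg (inv_nonneg.2 hI.le) f.nonneg, f.hasCompactSupport.mul_left,
    fun s hs => by simp [hf1 s hs], ?_⟩
  rw [integral_const_mul, inv_mul_cancel₀ hI.ne']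

lemma exists_antideriv {g : ℝ → ℝ} (hg : ContDiff ℝ 2 g) (h1 : ∀ s, 1 ≤ s → g s = 0) :
    ∃ G : ℝ → ℝ, ContDiff ℝ 2 G ∧ (∀ s, HasDerivAt G (g s) s) ∧ ∀ s, 1 ≤ s → G s = 0 := by
  have hd : ∀ s, HasDerivAt (fun u => ∫ t in (1 : ℝ)..u, g t) (g s) s := fun s =>
    (hg.continuous.integral_hasStrictDerivAt 1 s).hasDerivAt
  refine ⟨_, ?_, hd, fun s hs => ?_⟩
  · have : ContDiff ℝ (1 + 1) fun u => ∫ t in (1 : ℝ)..u, g t := by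
      rw [contDiff_succ_iff_deriv]
      refine ⟨fun s => (hd s).differentiableAt, by simp, ?_⟩
      rw [funext fun s => (hd s).deriv]
      exact hg.of_le (by norm_num)
    exact this
  · refine (intervalIntegral.integral_congr fun t ht => ?_).trans
      (intervalIntegral.integral_zero (μ := volume))
    rw [Set.uIcc_of_le hs] at ht
    exact h1 t ht.1

lemma hasFDerivAt_comp_norm_sub_sq {G : ℝ → ℝ} {G' a : ℝ} {p x : 𝔼 n}
    (hG : HasDerivAt G G' (a ^ 2 * ‖x - p‖ ^ 2)) :
    HasFDerivAt (fun z => G (a ^ 2 * ‖z - p‖ ^ 2))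
      (G' • (a ^ 2 • (2 • innerSL ℝ (x - p)))) x := by
  have h1 : HasFDerivAt (fun z : 𝔼 n => ‖z - p‖ ^ 2) (2 • innerSL ℝ (x - p)) x := by
    simpa using ((hasFDerivAt_id x).sub_const p).norm_sq
  exact hG.comp_hasFDerivAt x (h1.const_mul (a ^ 2))

lemma partialDeriv_comp_norm_sub_sq {G g : ℝ → ℝ} (hG : ∀ s, HasDerivAt G (g s) s) (a : ℝ)
    (p : 𝔼 n) (i : Fin n) :
    partialDeriv i (fun z => G (a ^ 2 * ‖z - p‖ ^ 2)) =
      fun x => g (a ^ 2 * ‖x - p‖ ^ 2) * (2 * a ^ 2 * (x i - p i)) := by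
  funext x
  rw [partialDeriv, (hasFDerivAt_comp_norm_sub_sq (hG _)).fderiv]
  simp [EuclideanSpace.inner_single_right]
  left
  ring

lemma laplace_comp_norm_sub_sq {G g : ℝ → ℝ} (hG : ∀ s, HasDerivAt G (g s) s)
    (hg : Differentiable ℝ g) (a : ℝ) (p x : 𝔼 n) :
    laplace (fun z => G (a ^ 2 * ‖z - p‖ ^ 2)) x =
      2 * a ^ 2 * (n * g (a ^ 2 * ‖x - p‖ ^ 2)
        + 2 * (a ^ 2 * ‖x - p‖ ^ 2) * deriv g (a ^ 2 * ‖x - p‖ ^ 2)) := by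
  have key : ∀ i, partialDeriv i (partialDeriv i (fun z => G (a ^ 2 * ‖z - p‖ ^ 2))) x =
      2 * a ^ 2 * g (a ^ 2 * ‖x - p‖ ^ 2)
      + 4 * a ^ 4 * deriv g (a ^ 2 * ‖x - p‖ ^ 2) * ((x - p) i) ^ 2 := by
    intro i
    have h1 := hasFDerivAt_comp_norm_sub_sq (p := p) (x := x) (a := a) (hg _).hasDerivAt
    have h2 : HasFDerivAt (fun z : 𝔼 n => 2 * a ^ 2 * (z i - p i))
        ((2 * a ^ 2) • EuclideanSpace.proj (𝕜 := ℝ) i) x :=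
      ((EuclideanSpace.proj (𝕜 := ℝ) i : (𝔼 n) →L[ℝ] ℝ).hasFDerivAt.sub_const (p i)).const_mul _
    have h3 : HasFDerivAt (fun z => g (a ^ 2 * ‖z - p‖ ^ 2) * (2 * a ^ 2 * (z i - p i))) _ x :=
      h1.mul h2
    rw [partialDeriv_comp_norm_sub_sq hG, partialDeriv, h3.fderiv]
    simp [EuclideanSpace.inner_single_right]
    ring
  simp only [laplace, key, Finset.sum_add_distrib, ← Finset.mul_sum]
  rw [← EuclideanSpace.real_norm_sq_eq]
  simp
  ring

lemma laplace_sub {f₁ f₂ : (𝔼 n) → ℝ} (h₁ : ContDiff ℝ 2 f₁) (h₂ : ContDiff ℝ 2 f₂) (x : 𝔼 n) :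
    laplace (fun z => f₁ z - f₂ z) x = laplace f₁ x - laplace f₂ x := by
  have hsub : ∀ {u v : (𝔼 n) → ℝ}, Differentiable ℝ u → Differentiable ℝ v → ∀ i,
      partialDeriv i (fun z => u z - v z) = fun z => partialDeriv i u z - partialDeriv i v z := by
    intro u v hu hv i
    funext z
    simp [partialDeriv, fderiv_fun_sub (hu z) (hv z)]
  have hd : ∀ {u : (𝔼 n) → ℝ}, ContDiff ℝ 2 u → ∀ i, Differentiable ℝ (partialDeriv i u) :=
    fun hu i => (contDiff_partialDeriv (m := 1) hu (by norm_num) i).differentiable (by norm_num)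
  simp only [laplace, hsub (h₁.differentiable (by norm_num)) (h₂.differentiable (by norm_num)),
    hsub (hd h₁ _) (hd h₂ _), Finset.sum_sub_distrib]

/-- Reflection across the hyperplane `y k = 0`. -/
noncomputable def reflect (k : Fin n) (x : 𝔼 n) : 𝔼 n := x - EuclideanSpace.single k (2 * x k)

lemma norm_sub_reflect_sq (k : Fin n) (x z : 𝔼 n) :
    ‖z - reflect k x‖ ^ 2 = ‖z - x‖ ^ 2 + 4 * x k * z k := by
  have : z - reflect k x = (z - x) + EuclideanSpace.single k (2 * x k) := by
    rw [reflect]; abel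
  rw [this, norm_add_sq_real, EuclideanSpace.inner_single_right, PiLp.norm_single]
  simp [mul_pow]
  ring

lemma norm_reflect (k : Fin n) (x : 𝔼 n) : ‖reflect k x‖ = ‖x‖ := by
  have := norm_sub_reflect_sq k x 0
  simp only [zero_sub, norm_neg, PiLp.zero_apply, mul_zero, add_zero] at this
  exact (sq_eq_sq₀ (norm_nonneg _) (norm_nonneg _)).1 this

section Representation

variable {k : Fin n} {h : (𝔼 n) → ℝ} {g : ℝ → ℝ}

lemma integral_kernel_deriv_eq_zero (hc : ContinuousOn h (closedHalfBall k))
    (hh : ContDiffOn ℝ 2 h (halfBall k)) (hlap : ∀ x ∈ halfBall k, laplace h x = 0)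
    (h0 : ∀ y ∈ closedHalfBall k, y k = 0 → h y = 0)
    (hg : ContDiff ℝ 2 g) (hg1 : ∀ s, 1 ≤ s → g s = 0)
    {x : 𝔼 n} (hx4 : ‖x‖ ≤ 1 / 4) {a : ℝ} (ha : 4 < a) :
    ∫ z in halfBall k, h z *
      ((n * g (a ^ 2 * ‖z - x‖ ^ 2)
          + 2 * (a ^ 2 * ‖z - x‖ ^ 2) * deriv g (a ^ 2 * ‖z - x‖ ^ 2))
        - (n * g (a ^ 2 * ‖z - reflect k x‖ ^ 2)
          + 2 * (a ^ 2 * ‖z - reflect k x‖ ^ 2) * deriv g (a ^ 2 * ‖z - reflect k x‖ ^ 2))) = 0 := by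
  obtain ⟨G, hG, hGd, hG1⟩ := exists_antideriv hg hg1
  have hsm : ∀ p : 𝔼 n, ContDiff ℝ 2 fun z : 𝔼 n => G (a ^ 2 * ‖z - p‖ ^ 2) := fun p =>
    hG.comp (contDiff_const.mul ((contDiff_id.sub contDiff_const).norm_sq ℝ))
  have hfar : ∀ p z : 𝔼 n, ‖p‖ ≤ 1 / 4 → 1 / 4 + 1 / a < ‖z‖ → G (a ^ 2 * ‖z - p‖ ^ 2) = 0 := by
    intro p z hp hz
    have h1 : 1 / a ≤ ‖z - p‖ := by linarith [norm_sub_norm_le z p]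
    have h2 : 1 ≤ a * ‖z - p‖ := by
      rw [div_le_iff₀ (by linarith)] at h1
      linarith
    refine hG1 _ ?_
    rw [← mul_pow]
    exact one_le_pow₀ h2
  have ha4 : 1 / a < 1 / 4 := one_div_lt_one_div_of_lt (by norm_num) ha
  have main := integral_halfBall_mul_laplace_eq_zero hc hh hlap h0
    (φ := fun z => G (a ^ 2 * ‖z - x‖ ^ 2) - G (a ^ 2 * ‖z - reflect k x‖ ^ 2))
    ((hsm x).sub (hsm _)) ?_ ?_
  · simp_rw [laplace_sub (hsm x) (hsm (reflect k x)),
      laplace_comp_norm_sub_sq hGd (hg.differentiable (by norm_num)), ← mul_sub,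
      mul_left_comm (h _) (2 * a ^ 2)] at main
    rw [integral_const_mul] at main
    exact (mul_eq_zero.1 main).resolve_left (by positivity)
  · refine (closure_minimal (t := closedBall (0 : 𝔼 n) (1 / 4 + 1 / a)) (fun z hz => ?_)
      isClosed_closedBall).trans (closedBall_subset_ball (by linarith))
    by_contra hz'
    rw [mem_closedBall_zero_iff, not_le] at hz'
    refine hz ?_
    simp only [hfar x z hx4 hz', hfar (reflect k x) z ((norm_reflect k x).trans_le hx4) hz',
      sub_zero]
  · intro z hz
    simp [norm_sub_reflect_sq, hz]

lemma hasDerivAt_integral_kernel (hc : ContinuousOn h (closedHalfBall k))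
    (hh : ContDiffOn ℝ 2 h (halfBall k)) (hlap : ∀ x ∈ halfBall k, laplace h x = 0)
    (h0 : ∀ y ∈ closedHalfBall k, y k = 0 → h y = 0)
    (hg : ContDiff ℝ 2 g) (hg1 : ∀ s, 1 ≤ s → g s = 0) (hgc : HasCompactSupport g)
    {x : 𝔼 n} (hx4 : ‖x‖ ≤ 1 / 4) {a : ℝ} (ha : 4 < a) :
    HasDerivAt (fun a => ∫ z in halfBall k, h z *
      (a ^ n * (g (a ^ 2 * ‖z - x‖ ^ 2) - g (a ^ 2 * ‖z - reflect k x‖ ^ 2)))) 0 a := by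
  have hn : n ≠ 0 := fun hn => by subst hn; exact k.elim0
  have hgd : Continuous (deriv g) := hg.continuous_deriv (by norm_num)
  set l : ℝ → ℝ := fun s => n * g s + 2 * s * deriv g s with hl
  have hlc : Continuous l := by have := hg.continuous; fun_prop
  obtain ⟨M, hM⟩ := HasCompactSupport.exists_bound_of_continuous
    (f := l) (hgc.mul_left.add hgc.deriv.mul_left) hlc
  have hM0 : 0 ≤ M := (norm_nonneg _).trans (hM 0)
  have hcont : ∀ (q : ℝ → ℝ) (a : ℝ) (m : ℕ), Continuous q → Continuous fun z : 𝔼 n =>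
      a ^ m * (q (a ^ 2 * ‖z - x‖ ^ 2) - q (a ^ 2 * ‖z - reflect k x‖ ^ 2)) := by
    intro q a m hq
    fun_prop
  have hh_int : IntegrableOn h (halfBall k) := by
    simpa using integrableOn_mul_of_continuousOn hc (continuous_const (y := (1 : ℝ)))
  have key := hasDerivAt_integral_of_dominated_loc_of_deriv_le
    (μ := volume.restrict (halfBall k)) (x₀ := a) (s := ball a 1)
    (F := fun a z => h z *
      (a ^ n * (g (a ^ 2 * ‖z - x‖ ^ 2) - g (a ^ 2 * ‖z - reflect k x‖ ^ 2))))
    (F' := fun a z => h z *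
      (a ^ (n - 1) * (l (a ^ 2 * ‖z - x‖ ^ 2) - l (a ^ 2 * ‖z - reflect k x‖ ^ 2))))
    (bound := fun z => ‖h z‖ * ((a + 1) ^ (n - 1) * (M + M)))
    (ball_mem_nhds a one_pos)
    (Filter.Eventually.of_forall fun b =>
      (integrableOn_mul_of_continuousOn hc (hcont g b n hg.continuous)).aestronglyMeasurable)
    (integrableOn_mul_of_continuousOn hc (hcont g a n hg.continuous))
    (integrableOn_mul_of_continuousOn hc (hcont l a (n - 1) hlc)).aestronglyMeasurable
    (Filter.Eventually.of_forall fun z b hb => ?_)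
    (hh_int.norm.mul_const _)
    (Filter.Eventually.of_forall fun z b _ => ?_)
  · have h2 := key.2
    rwa [show (∫ z in halfBall k, h z * (a ^ (n - 1) *
        (l (a ^ 2 * ‖z - x‖ ^ 2) - l (a ^ 2 * ‖z - reflect k x‖ ^ 2)))) = 0 by
      simp_rw [mul_left_comm (h _) (a ^ (n - 1))]
      rw [integral_const_mul,
        integral_kernel_deriv_eq_zero hc hh hlap h0 hg hg1 hx4 ha, mul_zero]] at h2
  · have hb1 : |b| ≤ a + 1 := by
      rw [mem_ball, Real.dist_eq] at hb
      have := abs_lt.1 hb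
      rw [abs_le]
      constructor <;> linarith
    rw [norm_mul, norm_mul, norm_pow, Real.norm_eq_abs b]
    gcongr
    exact (norm_sub_le _ _).trans (add_le_add (hM _) (hM _))
  · have hb : ∀ p : ℝ, HasDerivAt (fun b : ℝ => g (b ^ 2 * p))
        (deriv g (b ^ 2 * p) * (2 * b * p)) b := by
      intro p
      have h1 : HasDerivAt (fun b : ℝ => b ^ 2 * p) (2 * b * p) b := by
        simpa using (hasDerivAt_pow 2 b).mul_const p
      exact ((hg.differentiable (by norm_num)) _).hasDerivAt.comp b h1
    refine (((hasDerivAt_pow n b).mul ((hb (‖z - x‖ ^ 2)).sub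
      (hb (‖z - reflect k x‖ ^ 2)))).const_mul (h z)).congr_deriv ?_
    have hpow : b ^ n = b ^ (n - 1) * b := (pow_sub_one_mul hn b).symm
    rw [hpow, hl, Pi.sub_apply]
    ring

lemma tendsto_integral_kernel (hh_int : IntegrableOn h (halfBall k)) (hg0 : ∀ s, 0 ≤ g s)
    (hg1 : ∀ s, 1 ≤ s → g s = 0) (hgi : ∫ z : 𝔼 n, g (‖z‖ ^ 2) = 1) {p : 𝔼 n}
    (hp : ContinuousAt ((halfBall k).indicator h) p) :
    Filter.Tendsto (fun a : ℝ => ∫ z in halfBall k, h z * (a ^ n * g (a ^ 2 * ‖z - p‖ ^ 2)))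
      Filter.atTop (nhds ((halfBall k).indicator h p)) := by
  have hms := (isOpen_halfBall k).measurableSet
  have := tendsto_integral_comp_smul_smul_of_integrable' (μ := (volume : Measure (𝔼 n)))
    (φ := fun z => g (‖z‖ ^ 2)) (fun z => hg0 _) hgi ?_ ((integrable_indicator_iff hms).2 hh_int) hp
  · refine this.congr fun a => ?_
    rw [← integral_indicator hms]
    refine integral_congr_ae (Filter.Eventually.of_forall fun z => ?_)
    by_cases hz : z ∈ halfBall k
    · simp [hz, norm_smul, mul_pow, norm_sub_rev p z]
      ring
    · simp [hz]
  · refine tendsto_const_nhds.congr' ?_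
    filter_upwards [eventually_cobounded_le_norm (1 : ℝ)] with z hz
    simp [hg1 _ (one_le_pow₀ hz)]

/-- A harmonic function on the half ball that vanishes on the flat face is reproduced by an odd
radial kernel. -/
lemma eq_integral_kernel (hc : ContinuousOn h (closedHalfBall k))
    (hh : ContDiffOn ℝ 2 h (halfBall k)) (hlap : ∀ x ∈ halfBall k, laplace h x = 0)
    (h0 : ∀ y ∈ closedHalfBall k, y k = 0 → h y = 0)
    (hg : ContDiff ℝ 2 g) (hg0 : ∀ s, 0 ≤ g s) (hg1 : ∀ s, 1 ≤ s → g s = 0)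
    (hgc : HasCompactSupport g) (hgi : ∫ z : 𝔼 n, g (‖z‖ ^ 2) = 1)
    {x : 𝔼 n} (hxk : 0 < x k) (hx4 : ‖x‖ ≤ 1 / 4) {a : ℝ} (ha : 4 < a) :
    h x = ∫ z in halfBall k, h z *
      (a ^ n * (g (a ^ 2 * ‖z - x‖ ^ 2) - g (a ^ 2 * ‖z - reflect k x‖ ^ 2))) := by
  set F : ℝ → ℝ := fun a => ∫ z in halfBall k, h z *
      (a ^ n * (g (a ^ 2 * ‖z - x‖ ^ 2) - g (a ^ 2 * ‖z - reflect k x‖ ^ 2))) with hF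
  have hd : ∀ b, 4 < b → HasDerivAt F 0 b := fun b hb =>
    hasDerivAt_integral_kernel hc hh hlap h0 hg hg1 hgc hx4 hb
  have hconst : ∀ b, 4 < b → F b = F a := fun b hb =>
    isOpen_Ioi.is_const_of_deriv_eq_zero (convex_Ioi (4 : ℝ)).isPreconnected
      (fun c hc => (hd c hc).differentiableAt.differentiableWithinAt)
      (fun c hc => (hd c hc).deriv) hb ha
  have hh_int : IntegrableOn h (halfBall k) := by
    simpa using integrableOn_mul_of_continuousOn hc (continuous_const (y := (1 : ℝ)))
  have hxm : x ∈ halfBall k := ⟨hx4.trans_lt (by norm_num), hxk⟩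
  have hrk : (reflect k x) k < 0 := by simp [reflect]; linarith
  have hc1 : ContinuousAt ((halfBall k).indicator h) x := by
    refine (hh.continuousOn.continuousAt ((isOpen_halfBall k).mem_nhds hxm)).congr ?_
    filter_upwards [(isOpen_halfBall k).mem_nhds hxm] with z hz
    simp [hz]
  have hc2 : ContinuousAt ((halfBall k).indicator h) (reflect k x) := by
    refine (continuousAt_const (y := (0 : ℝ))).congr ?_
    filter_upwards [(isOpen_lt (EuclideanSpace.proj (𝕜 := ℝ) k : (𝔼 n) →L[ℝ] ℝ).continuous
      continuous_const).mem_nhds hrk] with z hz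
    have : z ∉ halfBall k := fun hz' => lt_asymm hz hz'.2
    simp [this]
  have hlim := (tendsto_integral_kernel hh_int hg0 hg1 hgi hc1).sub
    (tendsto_integral_kernel hh_int hg0 hg1 hgi hc2)
  have hr : reflect k x ∉ halfBall k := fun hr => lt_asymm hrk hr.2
  rw [Set.indicator_of_mem hxm, Set.indicator_of_notMem hr, sub_zero] at hlim
  refine tendsto_nhds_unique hlim ((tendsto_const_nhds (x := F a)).congr' ?_)
  filter_upwards [Filter.eventually_gt_atTop (4 : ℝ)] with b hb
  have hcont : ∀ p : 𝔼 n, Continuous fun z : 𝔼 n => b ^ n * g (b ^ 2 * ‖z - p‖ ^ 2) := by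
    have := hg.continuous
    intro p
    fun_prop
  rw [← hconst b hb, hF, ← integral_sub (integrableOn_mul_of_continuousOn hc (hcont _))
    (integrableOn_mul_of_continuousOn hc (hcont _))]
  simp only [mul_sub]

end Representation

lemma abs_sub_sub_deriv_mul_le {κ : ℝ → ℝ} (hκ : Differentiable ℝ κ) {Λ : NNReal}
    (hΛ : LipschitzWith Λ (deriv κ)) (p q t : ℝ) :
    |κ p - κ (p + t) + t * deriv κ q| ≤ Λ * (|t| + |p - q|) * |t| := by
  have hd : ∀ s, HasDerivAt (fun s => κ s - s * deriv κ q) (deriv κ s - deriv κ q) s := fun s =>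
    ((hκ s).hasDerivAt.sub ((hasDerivAt_id s).mul_const (deriv κ q))).congr_deriv (by simp)
  have := (convex_uIcc p (p + t)).norm_image_sub_le_of_norm_hasDerivWithin_le
    (C := Λ * (|t| + |p - q|)) (fun s _ => (hd s).hasDerivWithinAt) (fun s hs => ?_)
    Set.right_mem_uIcc Set.left_mem_uIcc
  · refine (le_of_eq ?_).trans (this.trans (le_of_eq ?_))
    · rw [Real.norm_eq_abs]
      congr 1
      ring
    · simp
  · refine (hΛ.norm_sub_le s q).trans ?_
    have h1 : |s - p| ≤ |t| := by
      have := Set.abs_sub_left_of_mem_uIcc hs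
      rwa [add_sub_cancel_left] at this
    gcongr
    calc ‖s - q‖ = |(s - p) + (p - q)| := by rw [Real.norm_eq_abs]; congr 1; ring
      _ ≤ |s - p| + |p - q| := abs_add_le _ _
      _ ≤ |t| + |p - q| := by gcongr

/-- Taylor expansion of the odd radial kernel at the origin. -/
lemma abs_kernel_sub_le {κ : ℝ → ℝ} (hκ : Differentiable ℝ κ) {Λ : NNReal}
    (hΛ : LipschitzWith Λ (deriv κ)) (k : Fin n) {x z : 𝔼 n} (hx : ‖x‖ ≤ 1 / 4)
    (hz : ‖z‖ ≤ 1 / 2) :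
    |κ (‖z - x‖ ^ 2) - κ (‖z - reflect k x‖ ^ 2) + 4 * x k * z k * deriv κ (‖z‖ ^ 2)|
      ≤ 8 * Λ * ‖x‖ ^ 2 := by
  rw [norm_sub_reflect_sq]
  refine (abs_sub_sub_deriv_mul_le hκ hΛ _ (‖z‖ ^ 2) _).trans ?_
  have h1 : |4 * x k * z k| ≤ 2 * ‖x‖ := by
    have hxk : |x k| ≤ ‖x‖ := PiLp.norm_apply_le x k
    have hzk : |z k| ≤ 1 / 2 := (PiLp.norm_apply_le z k).trans hz
    rw [abs_mul, abs_mul, abs_of_pos (four_pos (α := ℝ))]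
    nlinarith [abs_nonneg (x k), abs_nonneg (z k)]
  have h2 : |‖z - x‖ ^ 2 - ‖z‖ ^ 2| ≤ 2 * ‖x‖ := by
    have : |‖z - x‖ - ‖z‖| ≤ ‖x‖ := by
      simpa using abs_norm_sub_norm_le (z - x) z
    have h3 : ‖z - x‖ + ‖z‖ ≤ 2 := by linarith [norm_sub_le z x]
    rw [sq_sub_sq, abs_mul, abs_of_nonneg (by positivity)]
    gcongr
  calc Λ * (|4 * x k * z k| + |‖z - x‖ ^ 2 - ‖z‖ ^ 2|) * |4 * x k * z k|
      ≤ Λ * (2 * ‖x‖ + 2 * ‖x‖) * (2 * ‖x‖) := by gcongr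
    _ = 8 * Λ * ‖x‖ ^ 2 := by ring

/-- Cauchy-Schwarz against a bounded function on the half ball. -/
lemma ofReal_abs_integral_mul_le {k : Fin n} {h m : (𝔼 n) → ℝ}
    (hc : ContinuousOn h (closedHalfBall k)) {M : ℝ} (hM0 : 0 ≤ M)
    (hM : ∀ z ∈ halfBall k, |m z| ≤ M) :
    ENNReal.ofReal |∫ z in halfBall k, h z * m z| ≤
      ENNReal.ofReal (M * volume.real (halfBall k) ^ (1 / 2 : ℝ)) *
        (∫⁻ z in halfBall k, ENNReal.ofReal (h z ^ 2)) ^ (1 / 2 : ℝ) := by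
  have hms := (isOpen_halfBall k).measurableSet
  have hfin : volume (halfBall k) ≠ ⊤ :=
    ((measure_mono (halfBall_subset_closedHalfBall k)).trans_lt
      (isCompact_closedHalfBall k).measure_lt_top).ne
  have hmeas : AEMeasurable (fun z => ENNReal.ofReal |h z|) (volume.restrict (halfBall k)) :=
    ((hc.mono (halfBall_subset_closedHalfBall k)).aemeasurable hms).abs.ennreal_ofReal
  calc ENNReal.ofReal |∫ z in halfBall k, h z * m z|
      ≤ ∫⁻ z in halfBall k, ‖h z * m z‖ₑ := by
        rw [← Real.norm_eq_abs, ofReal_norm]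
        exact enorm_integral_le_lintegral_enorm _
    _ ≤ ∫⁻ z in halfBall k, ENNReal.ofReal |h z| * ENNReal.ofReal M := by
        refine setLIntegral_mono' hms fun z hz => ?_
        rw [← ENNReal.ofReal_mul (abs_nonneg _), ← ofReal_norm, norm_mul]
        exact ENNReal.ofReal_le_ofReal (mul_le_mul_of_nonneg_left (hM z hz) (abs_nonneg _))
    _ ≤ (∫⁻ z in halfBall k, ENNReal.ofReal |h z| ^ (2 : ℝ)) ^ (1 / 2 : ℝ) *
          (∫⁻ _ in halfBall k, ENNReal.ofReal M ^ (2 : ℝ)) ^ (1 / 2 : ℝ) :=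
        ENNReal.lintegral_mul_le_Lp_mul_Lq _ Real.HolderConjugate.two_two hmeas
          aemeasurable_const
    _ = _ := by
        rw [mul_comm]
        congr 1
        · rw [setLIntegral_const, ENNReal.mul_rpow_of_nonneg _ _ (by norm_num),
            ← ENNReal.rpow_mul, ENNReal.ofReal_mul hM0,
            ← ENNReal.ofReal_rpow_of_nonneg measureReal_nonneg (by norm_num),
            ofReal_measureReal hfin]
          norm_num
        · congr 1
          refine lintegral_congr fun z => ?_
          rw [ENNReal.ofReal_rpow_of_nonneg (abs_nonneg _) (by norm_num)]
          norm_num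

/-- Existence of the normal derivative at the origin, with the `L²` bounds. -/
theorem exists_normal_derivative (k : Fin n) : ∃ C : ℝ, ∀ h : (𝔼 n) → ℝ,
    ContinuousOn h (closedHalfBall k) → IsHarmonicOn h (halfBall k) →
    (∀ y ∈ closedHalfBall k, y k = 0 → h y = 0) →
    ∃ β : ℝ,
      Filter.Tendsto (fun t : ℝ => h (t • (EuclideanSpace.single k (1 : ℝ))) / t)
        (nhdsWithin 0 (Set.Ioi 0)) (nhds β) ∧
      ENNReal.ofReal |β| ≤ ENNReal.ofReal C *
        (∫⁻ z in halfBall k, ENNReal.ofReal (h z ^ 2)) ^ ((1 : ℝ) / 2) ∧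
      ∀ y : 𝔼 n, 0 < y k → ‖y‖ ≤ 1 / 4 →
        ENNReal.ofReal |h y - β * y k| ≤ ENNReal.ofReal (C * ‖y‖ ^ 2) *
          (∫⁻ z in halfBall k, ENNReal.ofReal (h z ^ 2)) ^ ((1 : ℝ) / 2) := by
  obtain ⟨g, hg, hg0, hgc, hg1, hgi⟩ := exists_radial_profile n
  set κ : ℝ → ℝ := fun s => 5 ^ n * g (5 ^ 2 * s) with hκdef
  have hκ : ContDiff ℝ 2 κ := contDiff_const.mul (hg.comp (contDiff_const.mul contDiff_id))
  have hκc : HasCompactSupport κ :=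
    (hgc.comp_homeomorph (Homeomorph.mulLeft₀ (5 ^ 2 : ℝ) (by norm_num))).mul_left
  have hκ' : ContDiff ℝ 1 (deriv κ) := hκ.deriv' (n := 1)
  have hκd : Differentiable ℝ κ := hκ.differentiable (by norm_num)
  obtain ⟨M, hM⟩ := hκc.deriv.exists_bound_of_continuous hκ'.continuous
  obtain ⟨Λ, hΛ⟩ := ContDiff.lipschitzWith_of_hasCompactSupport hκc.deriv hκ' (by norm_num)
  have hM0 : 0 ≤ M := (norm_nonneg _).trans (hM 0)
  set v := volume.real (halfBall k) ^ (1 / 2 : ℝ) with hv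
  have hv0 : 0 ≤ v := Real.rpow_nonneg measureReal_nonneg _
  refine ⟨(2 * M + 8 * Λ) * v, fun h hc ⟨hh, hlap⟩ h0 => ?_⟩
  set β := ∫ z in halfBall k, h z * (-(4 * z k * deriv κ (‖z‖ ^ 2))) with hβ
  have hsub : ∀ y : 𝔼 n, 0 < y k → ‖y‖ ≤ 1 / 4 → h y - β * y k = ∫ z in halfBall k, h z *
      (κ (‖z - y‖ ^ 2) - κ (‖z - reflect k y‖ ^ 2) + 4 * y k * z k * deriv κ (‖z‖ ^ 2)) := by
    intro y hyk hy
    rw [eq_integral_kernel hc hh hlap h0 hg hg0 hg1 hgc hgi hyk hy (by norm_num : (4 : ℝ) < 5), hβ,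
      ← integral_mul_const, ← integral_sub]
    · refine integral_congr_ae (Filter.Eventually.of_forall fun z => ?_)
      simp only [hκdef]
      ring
    · refine integrableOn_mul_of_continuousOn hc ?_
      have := hg.continuous
      fun_prop
    · refine (integrableOn_mul_of_continuousOn hc ?_).mul_const _
      have := hκ'.continuous
      fun_prop
  have hker : ∀ y : 𝔼 n, ‖y‖ ≤ 1 / 4 → ∀ z ∈ halfBall k,
      |κ (‖z - y‖ ^ 2) - κ (‖z - reflect k y‖ ^ 2) + 4 * y k * z k * deriv κ (‖z‖ ^ 2)|
        ≤ 8 * Λ * ‖y‖ ^ 2 := fun y hy z hz => abs_kernel_sub_le hκd hΛ k hy hz.1.le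
  have hh_int : IntegrableOn h (halfBall k) := by
    simpa using integrableOn_mul_of_continuousOn hc (continuous_const (y := (1 : ℝ)))
  refine ⟨β, ?_, ?_, fun y hyk hy => ?_⟩
  · rw [tendsto_iff_norm_sub_tendsto_zero]
    have hlim : Filter.Tendsto (fun t : ℝ => (∫ z in halfBall k, ‖h z‖) * (8 * Λ) * t)
        (nhdsWithin 0 (Set.Ioi 0)) (nhds 0) := by
      refine Filter.Tendsto.mono_left ?_ nhdsWithin_le_nhds
      exact (by fun_prop : Continuous fun t : ℝ => (∫ z in halfBall k, ‖h z‖) * (8 * Λ) * t).tendsto'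
        0 0 (by simp)
    refine squeeze_zero' (Filter.Eventually.of_forall fun t => norm_nonneg _) ?_ hlim
    filter_upwards [Ioc_mem_nhdsGT (show (0 : ℝ) < 1 / 4 by norm_num)] with t ht
    set y : 𝔼 n := t • EuclideanSpace.single k (1 : ℝ) with hy
    have hyk : y k = t := by simp [hy]
    have hyn : ‖y‖ = t := by simp [hy, norm_smul, abs_of_pos ht.1]
    have h1 : ‖h y - β * y k‖ ≤ ∫ z in halfBall k, ‖h z‖ * (8 * Λ * t ^ 2) := by
      rw [hsub y (hyk ▸ ht.1) (hyn.trans_le ht.2)]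
      refine norm_integral_le_of_norm_le (hh_int.norm.mul_const _) ?_
      refine (ae_restrict_iff' (isOpen_halfBall k).measurableSet).2
        (Filter.Eventually.of_forall fun z hz => ?_)
      rw [norm_mul, ← hyn]
      exact mul_le_mul_of_nonneg_left (hker y (hyn.trans_le ht.2) z hz) (norm_nonneg _)
    rw [integral_mul_const] at h1
    have h2 : h y / t - β = (h y - β * y k) / t := by
      rw [hyk]
      field_simp [ht.1.ne']
    rw [h2, norm_div, Real.norm_of_nonneg ht.1.le, div_le_iff₀ ht.1]
    exact h1.trans (le_of_eq (by ring))
  · refine (ofReal_abs_integral_mul_le hc (M := 2 * M) (by positivity) fun z hz => ?_).trans ?_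
    · have hzk : |z k| ≤ 1 / 2 := (PiLp.norm_apply_le z k).trans hz.1.le
      have hd : |deriv κ (‖z‖ ^ 2)| ≤ M := hM _
      rw [abs_neg, abs_mul, abs_mul, abs_of_pos (four_pos (α := ℝ))]
      calc 4 * |z k| * |deriv κ (‖z‖ ^ 2)| ≤ 4 * (1 / 2) * M := by gcongr
        _ = 2 * M := by ring
    · gcongr
      exact le_add_of_nonneg_right (by positivity)
  · rw [hsub y hyk hy]
    refine (ofReal_abs_integral_mul_le hc (by positivity) (hker y hy)).trans ?_
    gcongr ENNReal.ofReal ?_ * _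
    calc 8 * Λ * ‖y‖ ^ 2 * v ≤ (8 * Λ * ‖y‖ ^ 2 + 2 * M * ‖y‖ ^ 2) * v := by
          gcongr
          exact le_add_of_nonneg_right (by positivity)
      _ = (2 * M + 8 * Λ) * v * ‖y‖ ^ 2 := by ring

end HarmonicHalfBall

/-- quantitative bound on harmonic blow-ups. The normal derivative `β` at the
origin exists, is controlled by the L² norm on `V ∩ B(0,1/2)`, and `h` is approximated to
second order by `β·yₙ` near the origin. -/
theorem stmt_10 (n : ℕ) (hn : 2 ≤ n) :
    ∃ C : ℝ, ∀ (V L : Set (EuclideanSpace ℝ (Fin n))),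
      V = {y : EuclideanSpace ℝ (Fin n) | ‖y‖ < 1 ∧ 0 < y ⟨n - 1, by omega⟩} →
      L = {y : EuclideanSpace ℝ (Fin n) | ‖y‖ < 1 ∧ y ⟨n - 1, by omega⟩ = 0} →
      ∀ h : EuclideanSpace ℝ (Fin n) → ℝ,
        ContinuousOn h (V ∪ L) → IsHarmonicOn h V → (∀ y ∈ L, h y = 0) →
        ∃ β : ℝ,
          Filter.Tendsto
            (fun t : ℝ =>
              h (t • (EuclideanSpace.single (⟨n - 1, by omega⟩ : Fin n) (1 : ℝ))) / t)
            (nhdsWithin 0 (Set.Ioi 0)) (nhds β) ∧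
          ENNReal.ofReal |β| ≤ ENNReal.ofReal C *
            (∫⁻ z in V ∩ ball (0 : EuclideanSpace ℝ (Fin n)) (1 / 2),
              ENNReal.ofReal ((h z) ^ 2)) ^ ((1 : ℝ) / 2) ∧
          ∀ y ∈ V, ‖y‖ ≤ 1 / 4 →
            ENNReal.ofReal |h y - β * y ⟨n - 1, by omega⟩| ≤
              ENNReal.ofReal (C * ‖y‖ ^ 2) *
                (∫⁻ z in V ∩ ball (0 : EuclideanSpace ℝ (Fin n)) (1 / 2),
                  ENNReal.ofReal ((h z) ^ 2)) ^ ((1 : ℝ) / 2) := by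
  obtain ⟨C, hC⟩ := HarmonicHalfBall.exists_normal_derivative (⟨n - 1, by omega⟩ : Fin n)
  refine ⟨C, fun V L hV hL h hc hh h0 => ?_⟩
  have hVL : HarmonicHalfBall.closedHalfBall (⟨n - 1, by omega⟩ : Fin n) ⊆ V ∪ L := by
    intro y hy
    have hy1 : ‖y‖ < 1 := hy.1.trans_lt (by norm_num)
    rw [hV, hL]
    exact hy.2.lt_or_eq.imp (fun hk => ⟨hy1, hk⟩) fun hk => ⟨hy1, hk.symm⟩
  have hsub : HarmonicHalfBall.halfBall (⟨n - 1, by omega⟩ : Fin n) ⊆ V := by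
    intro y hy
    rw [hV]
    exact ⟨hy.1.trans (by norm_num), hy.2⟩
  have hball : V ∩ ball 0 (1 / 2) = HarmonicHalfBall.halfBall (⟨n - 1, by omega⟩ : Fin n) := by
    refine Set.Subset.antisymm (fun y hy => ?_) fun y hy => ⟨hsub hy, by simpa using hy.1⟩
    rw [hV] at hy
    exact ⟨by simpa using hy.2, hy.1.2⟩
  obtain ⟨β, hlim, hβ, hest⟩ := hC h (hc.mono hVL) ⟨hh.1.mono hsub, fun y hy => hh.2 y (hsub hy)⟩
    fun y hy hk => h0 y (by rw [hL]; exact ⟨hy.1.trans_lt (by norm_num), hk⟩)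
  rw [hball]
  refine ⟨β, hlim, hβ, fun y hy => hest y ?_⟩
  rw [hV] at hy
  exact hy.2
end
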